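/- Let ‖·‖ be a differentiable, strictly convex norm on ℝ² and let α ∈ [0,π/2). Let u_x and u_y be the unit tangent vectors to the unit sphere of ‖·‖ associated with the directions α and α+π/2, and let w_b and w_{b'} be tangent directions to the unit sphere at its points in the directions α+π/4 and α+3π/4 (the two brace directions). Then u_x and u_y are linearly independent and there exist unique positive reals λ, λ′ such that λu_x + u_y is parallel to w_b and −λ′u_x + u_y is parallel to w_{b'}. -/

import Mathlib

open Asymptotics

abbrev V2 : Type := ℝ × ℝ

/-- The standard dot product on `ℝ × ℝ`. -/
def dot (v w : V2) : ℝ := v.1 * w.1 + v.2 * w.2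

/-- The Euclidean norm on `ℝ × ℝ`. -/
noncomputable def eucNorm (v : V2) : ℝ := Real.sqrt (v.1 ^ 2 + v.2 ^ 2)

/-- Rotation by `π/2`. -/
def rot90 (v : V2) : V2 := (-v.2, v.1)

/-- A bar-joint framework in the plane: a placement of joints and a set of bars. -/
structure Framework (J : Type) where
  pos : J → V2
  bars : Set (J × J)

/-- A Euclidean infinitesimal flex. -/
def IsEucFlex {J : Type} (F : Framework J) (u : J → V2) : Prop :=
  ∀ e ∈ F.bars, dot (u e.1 - u e.2) (F.pos e.1 - F.pos e.2) = 0

/-- A Euclidean rigid motion flex: `u i = c + θ • J (p i)`. -/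
def IsRigidMotionFlex {J : Type} (F : Framework J) (u : J → V2) : Prop :=
  ∃ (c : V2) (θ : ℝ), ∀ i, u i = c + θ • rot90 (F.pos i)

/-- Euclidean infinitesimal rigidity. -/
def EucRigid {J : Type} (F : Framework J) : Prop :=
  ∀ u, IsEucFlex F u → IsRigidMotionFlex F u

/-- An infinitesimal flex with respect to a general norm `ν`:
`ν (p i + t u i - (p j + t u j)) - ν (p i - p j) = o(t)` as `t → 0+`, for each bar. -/
def IsFlex (ν : V2 → ℝ) {J : Type} (F : Framework J) (u : J → V2) : Prop :=
  ∀ e ∈ F.bars,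
    (fun t : ℝ =>
        ν (F.pos e.1 + t • u e.1 - (F.pos e.2 + t • u e.2)) - ν (F.pos e.1 - F.pos e.2))
      =o[nhdsWithin 0 (Set.Ioi 0)] (id : ℝ → ℝ)

/-- Infinitesimal rigidity for a (non-Euclidean) norm: every flex is a translation,
i.e. a constant velocity field. -/
def NormRigid (ν : V2 → ℝ) {J : Type} (F : Framework J) : Prop :=
  ∀ u, IsFlex ν F u → ∀ i j, u i = u j

/-- `ν` is a norm on `ℝ²`. -/
def IsNormFn (ν : V2 → ℝ) : Prop :=
  (∀ v, ν v = 0 ↔ v = 0) ∧ (∀ (c : ℝ) (v : V2), ν (c • v) = |c| * ν v) ∧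
    ∀ v w : V2, ν (v + w) ≤ ν v + ν w

/-- `ν` is differentiable (away from the origin). -/
def SmoothNorm (ν : V2 → ℝ) : Prop := ∀ v : V2, v ≠ 0 → DifferentiableAt ℝ ν v

/-- `ν` is strictly convex. -/
def StrictlyConvexNorm (ν : V2 → ℝ) : Prop :=
  ∀ v w : V2, ν v = 1 → ν w = 1 → v ≠ w → ν ((1 / 2 : ℝ) • (v + w)) < 1

/-- `ν` is not a scalar multiple of the Euclidean norm. -/
def NonEuclidean (ν : V2 → ℝ) : Prop := ¬∃ c : ℝ, ∀ v, ν v = c * eucNorm v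

/-- The point of the unit sphere of `ν` in the direction `θ`. -/
noncomputable def sphPt (ν : V2 → ℝ) (θ : ℝ) : V2 :=
  (ν (Real.cos θ, Real.sin θ))⁻¹ • ((Real.cos θ, Real.sin θ) : V2)

/-- `w` is tangent to the unit sphere of `ν` at the point `q`. -/
def IsTangentAt (ν : V2 → ℝ) (q w : V2) : Prop := fderiv ℝ ν q w = 0

/-- The positively oriented unit tangent vector to the unit sphere of `ν`
at its point in the direction `θ`. -/
def IsPosUnitTangent (ν : V2 → ℝ) (θ : ℝ) (w : V2) : Prop :=
  ν w = 1 ∧ IsTangentAt ν (sphPt ν θ) w ∧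
    0 < (sphPt ν θ).1 * w.2 - (sphPt ν θ).2 * w.1

/-- Rotation of the plane by the angle `α`. -/
noncomputable def rotv (α : ℝ) (v : V2) : V2 :=
  (v.1 * Real.cos α - v.2 * Real.sin α, v.1 * Real.sin α + v.2 * Real.cos α)

/-- The joints of the `m × n` grid. -/
abbrev Joint (m n : ℕ) := Fin (m + 1) × Fin (n + 1)

/-- A brace: a square `(j,k)` together with a colour (`true` = blue diagonal
from `(j,k)` to `(j+1,k+1)`, `false` = red diagonal from `(j+1,k)` to `(j,k+1)`). -/
abbrev Brace (m n : ℕ) := Fin m × Fin n × Bool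

/-- The bars of the unbraced `m × n` grid: unit horizontal and vertical segments. -/
def gridBars (m n : ℕ) : Set (Joint m n × Joint m n) :=
  {e | ((e.1.1 : ℕ) + 1 = (e.2.1 : ℕ) ∧ e.1.2 = e.2.2) ∨
      (e.1.1 = e.2.1 ∧ (e.1.2 : ℕ) + 1 = (e.2.2 : ℕ))}

/-- The bar corresponding to a brace. -/
def braceBar {m n : ℕ} (b : Brace m n) : Joint m n × Joint m n :=
  if b.2.2 then ((b.1.castSucc, b.2.1.castSucc), (b.1.succ, b.2.1.succ))
  else ((b.1.succ, b.2.1.castSucc), (b.1.castSucc, b.2.1.succ))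

/-- The axis-aligned braced `m × n` grid framework `G(B)`. -/
noncomputable def plainBracedGrid (m n : ℕ) (B : Set (Brace m n)) : Framework (Joint m n) where
  pos := fun v => ((v.1 : ℝ), (v.2 : ℝ))
  bars := gridBars m n ∪ braceBar '' B

/-- The braced `m × n` grid framework `G(B)` of inclination `α`. -/
noncomputable def bracedGrid (m n : ℕ) (α : ℝ) (B : Set (Brace m n)) : Framework (Joint m n) where
  pos := fun v => rotv α ((v.1 : ℝ), (v.2 : ℝ))
  bars := gridBars m n ∪ braceBar '' B

/-- The braced `m × n` grid of `a × b` rectangles with inclination `α`. -/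
noncomputable def bracedRectGrid (m n : ℕ) (a b α : ℝ) (B : Set (Brace m n)) :
    Framework (Joint m n) where
  pos := fun v => rotv α ((v.1 : ℝ) * a, (v.2 : ℝ) * b)
  bars := gridBars m n ∪ braceBar '' B

/-- The unbraced axis-aligned `m × n` grid framework. -/
noncomputable def unbracedGrid (m n : ℕ) : Framework (Joint m n) where
  pos := fun v => ((v.1 : ℝ), (v.2 : ℝ))
  bars := gridBars m n

/-- The lines of the grid: `Sum.inl k` is the horizontal line at height `k`,
`Sum.inr j` is the vertical line at abscissa `j`. -/
abbrev LineIdx (m n : ℕ) := Fin (n + 1) ⊕ Fin (m + 1)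

/-- The basis velocity field `u_l` supported on the joints of the line `l`. -/
def lineField (m n : ℕ) (l : LineIdx m n) : Joint m n → V2 := fun v =>
  match l with
  | Sum.inl k => if v.2 = k then (1, 0) else (0, 0)
  | Sum.inr j => if v.1 = j then (0, 1) else (0, 0)

/-- The ribbons of the grid: `Sum.inl j` is the vertical ribbon `[j,j+1] × [0,n]`,
`Sum.inr k` is the horizontal ribbon `[0,m] × [k,k+1]`. -/
abbrev RibbonIdx (m n : ℕ) := Fin m ⊕ Fin n

/-- The sheer map on coefficient fields: `σ(u)(ρ) = d_{l₁} - d_{l₂}` for the boundary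
lines `l₁` (right-hand, resp. lower) and `l₂` of the ribbon `ρ`. -/
def sheer {m n : ℕ} (d : LineIdx m n → ℝ) : RibbonIdx m n → ℝ := fun ρ =>
  match ρ with
  | Sum.inl j => d (Sum.inr j.succ) - d (Sum.inr j.castSucc)
  | Sum.inr k => d (Sum.inl k.castSucc) - d (Sum.inl k.succ)

/-- The row of the Euclidean stress-sheer matrix indexed by a brace. -/
def eucSSRow {m n : ℕ} (b : Brace m n) : RibbonIdx m n → ℝ := fun ρ =>
  match ρ with
  | Sum.inl j => if j = b.1 then 1 else 0
  | Sum.inr k => if k = b.2.1 then -1 else 0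

/-- The row of the Euclidean stress-sheer matrix of the fully braced grid
indexed by a square. -/
def eucSqRow {m n : ℕ} (s : Fin m × Fin n) : RibbonIdx m n → ℝ := fun ρ =>
  match ρ with
  | Sum.inl j => if j = s.1 then 1 else 0
  | Sum.inr k => if k = s.2 then -1 else 0

/-- The row of the non-Euclidean stress-sheer matrix `SS_{λ,λ'}` indexed by a brace:
`+1` at the vertical ribbon, `-λ` (blue) or `-λ'` (red) at the horizontal ribbon. -/
def neRow {m n : ℕ} (lam lam' : ℝ) (b : Brace m n) : RibbonIdx m n → ℝ := fun ρ =>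
  match ρ with
  | Sum.inl j => if j = b.1 then 1 else 0
  | Sum.inr k => if k = b.2.1 then (if b.2.2 then -lam else -lam') else 0

/-- Adjacency of rows (`Sum.inl`) and columns (`Sum.inr`) in the (bicoloured) braces
graph with edge set `B`. -/
def bracesAdj {m n : ℕ} (B : Set (Brace m n)) (v w : Fin m ⊕ Fin n) : Prop :=
  ∃ e ∈ B, (v = Sum.inl e.1 ∧ w = Sum.inr e.2.1) ∨ (w = Sum.inl e.1 ∧ v = Sum.inr e.2.1)

/-- A (bicoloured) cycle of length `2(k+1)` in `K²_{m,n}`: rows `row 0, …, row k`,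
columns `col 0, …, col k`, odd edges `e_{2i+1} = (row i, col i, c1 i)` and even edges
`e_{2i+2} = (row (i+1), col i, c2 i)` (cyclically); all `2(k+1)` edges are distinct. -/
structure BCycle (m n : ℕ) where
  k : ℕ
  row : Fin (k + 1) → Fin m
  col : Fin (k + 1) → Fin n
  c1 : Fin (k + 1) → Bool
  c2 : Fin (k + 1) → Bool
  rowInj : Function.Injective row
  colInj : Function.Injective col
  nontriv : k = 0 → c1 ≠ c2

/-- The odd edges of a bicoloured cycle. -/
def BCycle.edge1 {m n : ℕ} (C : BCycle m n) (i : Fin (C.k + 1)) : Brace m n :=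
  (C.row i, C.col i, C.c1 i)

/-- The even edges of a bicoloured cycle. -/
def BCycle.edge2 {m n : ℕ} (C : BCycle m n) (i : Fin (C.k + 1)) : Brace m n :=
  (C.row (i + 1), C.col i, C.c2 i)

/-- The edge set of a bicoloured cycle. -/
def BCycle.edges {m n : ℕ} (C : BCycle m n) : Set (Brace m n) :=
  Set.range C.edge1 ∪ Set.range C.edge2

/-- Dependent colouring: the number of blue edges in odd position equals the number
of blue edges in even position. -/
def BCycle.DepColouring {m n : ℕ} (C : BCycle m n) : Prop :=
  (Finset.univ.filter fun i => C.c1 i = true).card =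
    (Finset.univ.filter fun i => C.c2 i = true).card

/-- Linear independence of the set of rows of `SS_{λ,λ'}` indexed by `S`. -/
def RowsIndep (m n : ℕ) (lam lam' : ℝ) (S : Set (Brace m n)) : Prop :=
  LinearIndependent ℝ fun e : S => neRow lam lam' (e : Brace m n)

/-- `S` is a circuit of the row matroid of `SS_{λ,λ'}`: a minimal dependent set of rows. -/
def IsCircuit (m n : ℕ) (lam lam' : ℝ) (S : Set (Brace m n)) : Prop :=
  ¬RowsIndep m n lam lam' S ∧ ∀ S' ⊂ S, RowsIndep m n lam lam' S'

/-- `S ⊆ K²_{m,n}` is a spanning independent cycle-rooted forest: every connected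
component (of the multigraph with edge set `S` on the `m + n` vertices) has as many
edges as vertices, i.e. is a cycle-rooted tree (so in particular `S` is spanning),
and every cycle of edges in `S` has an independent colouring. -/
def IsSpanningICRF (m n : ℕ) (S : Set (Brace m n)) : Prop :=
  (∀ v : Fin m ⊕ Fin n,
      {e ∈ S | Relation.ReflTransGen (bracesAdj S) v (Sum.inl e.1)}.ncard =
        {w | Relation.ReflTransGen (bracesAdj S) v w}.ncard) ∧
  ∀ C : BCycle m n, C.edges ⊆ S → ¬C.DepColouring

/-- The `p`-norm on the plane. -/
noncomputable def pNorm (p : ℝ) : V2 → ℝ := fun v => (|v.1| ^ p + |v.2| ^ p) ^ (1 / p)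

/-- The sup norm on the plane. -/
noncomputable def supNorm : V2 → ℝ := fun v => max |v.1| |v.2|

open Filter Topology

/-- The determinant of a pair of vectors of the plane. -/
def planeDet (v w : V2) : ℝ := v.1 * w.2 - v.2 * w.1

/-- Right-hand difference quotients of a differentiable function converge to its derivative. -/
lemma DifferentiableAt.tendsto_slope_right {ν : V2 → ℝ} {q : V2}
    (hd : DifferentiableAt ℝ ν q) (w : V2) :
    Tendsto (fun t : ℝ => t⁻¹ * (ν (q + t • w) - ν q)) (𝓝[>] 0) (𝓝 (fderiv ℝ ν q w)) := by
  have h := (hd.hasFDerivAt.hasLineDerivAt w).tendsto_slope_zero_right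
  simpa using h

namespace IsNormFn

variable {ν : V2 → ℝ}

lemma map_neg (h : IsNormFn ν) (v : V2) : ν (-v) = ν v := by
  have := h.2.1 (-1) v
  simpa using this

lemma pos (h : IsNormFn ν) {v : V2} (hv : v ≠ 0) : 0 < ν v := by
  have h0 : ν 0 = 0 := (h.1 0).2 rfl
  have h1 := h.2.2 v (-v)
  rw [add_neg_cancel, h0, h.map_neg] at h1
  have h2 : ν v ≠ 0 := fun h3 => hv ((h.1 v).1 h3)
  exact lt_of_le_of_ne (by linarith) h2.symm

lemma ne_zero_of_eq_one (h : IsNormFn ν) {q : V2} (hq : ν q = 1) : q ≠ 0 := by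
  rintro rfl
  rw [(h.1 0).2 rfl] at hq
  exact zero_ne_one hq

lemma fderiv_le (h : IsNormFn ν) {q : V2} (hd : DifferentiableAt ℝ ν q) (w : V2) :
    fderiv ℝ ν q w ≤ ν w := by
  refine le_of_tendsto (hd.tendsto_slope_right w) ?_
  filter_upwards [self_mem_nhdsWithin] with t ht
  have ht : 0 < t := ht
  have h1 := h.2.2 q (t • w)
  rw [h.2.1, abs_of_pos ht] at h1
  rw [inv_mul_le_iff₀ ht]
  linarith

lemma fderiv_self (h : IsNormFn ν) {q : V2} (hd : DifferentiableAt ℝ ν q) :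
    fderiv ℝ ν q q = ν q := by
  refine tendsto_nhds_unique (hd.tendsto_slope_right q) (tendsto_const_nhds.congr' ?_)
  filter_upwards [self_mem_nhdsWithin] with t ht
  have ht : 0 < t := ht
  have h1 := h.2.1 (1 + t) q
  rw [add_smul, one_smul, abs_of_pos (by linarith)] at h1
  rw [h1]
  field_simp
  ring

lemma fderiv_lt_one (h : IsNormFn ν) (hconv : StrictlyConvexNorm ν) {q v : V2}
    (hd : DifferentiableAt ℝ ν q) (hq : ν q = 1) (hv : ν v = 1) (hqv : q ≠ v) :
    fderiv ℝ ν q v < 1 := by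
  have h1 := (h.fderiv_le hd ((1 / 2 : ℝ) • (q + v))).trans_lt (hconv q v hq hv hqv)
  rw [map_smul, map_add, h.fderiv_self hd, hq, smul_eq_mul] at h1
  linarith

lemma abs_fderiv_lt_one (h : IsNormFn ν) (hconv : StrictlyConvexNorm ν) {q v : V2}
    (hd : DifferentiableAt ℝ ν q) (hq : ν q = 1) (hv : ν v = 1) (hqv : planeDet q v ≠ 0) :
    |fderiv ℝ ν q v| < 1 := by
  have h1 : q ≠ v := by
    rintro rfl
    exact hqv (by unfold planeDet; ring)
  have h2 : q ≠ -v := by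
    rintro rfl
    exact hqv (by simp [planeDet]; ring)
  have h3 := h.fderiv_lt_one hconv hd hq (by rw [h.map_neg, hv]) h2
  rw [_root_.map_neg] at h3
  exact abs_lt.2 ⟨by linarith, h.fderiv_lt_one hconv hd hq hv h1⟩

/-- The derivative of the norm at `q'` of a positively oriented tangent vector at `q` has the
sign of the determinant of `q` and `q'`. -/
lemma planeDet_mul_fderiv_pos (h : IsNormFn ν) (hdiff : SmoothNorm ν)
    (hconv : StrictlyConvexNorm ν) {q q' u : V2} (hq : ν q = 1) (hq' : ν q' = 1)
    (hu : IsTangentAt ν q u) (hpos : 0 < planeDet q u) (hdet : planeDet q q' ≠ 0) :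
    0 < planeDet q q' * fderiv ℝ ν q' u := by
  have hd := hdiff q (h.ne_zero_of_eq_one hq)
  have hd' := hdiff q' (h.ne_zero_of_eq_one hq')
  have hdet' : planeDet q' q ≠ 0 := by
    intro h0
    apply hdet
    unfold planeDet at *
    linarith
  have hdecomp : planeDet q u • q' = planeDet q' u • q + planeDet q q' • u := by
    ext <;> simp [planeDet] <;> ring
  have e1 := congrArg (fderiv ℝ ν q) hdecomp
  have e2 := congrArg (fderiv ℝ ν q') hdecomp
  have hu' : fderiv ℝ ν q u = 0 := hu
  simp only [map_add, map_smul, smul_eq_mul, h.fderiv_self hd, h.fderiv_self hd', hq, hq', hu']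
    at e1 e2
  have b1 := h.abs_fderiv_lt_one hconv hd hq hq' hdet
  have b2 := h.abs_fderiv_lt_one hconv hd' hq' hq hdet'
  have b3 : fderiv ℝ ν q q' * fderiv ℝ ν q' q < 1 := by
    refine (le_abs_self _).trans_lt ?_
    rw [abs_mul]
    exact mul_lt_one_of_nonneg_of_lt_one_left (abs_nonneg _) b1 b2.le
  have e3 : planeDet q q' * fderiv ℝ ν q' u =
      planeDet q u * (1 - fderiv ℝ ν q q' * fderiv ℝ ν q' q) := by
    linear_combination -e2 + fderiv ℝ ν q' q * e1
  rw [e3]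
  exact mul_pos hpos (by linarith)

lemma cos_sin_pos (h : IsNormFn ν) (θ : ℝ) : 0 < ν (Real.cos θ, Real.sin θ) := by
  apply h.pos
  intro h0
  have h1 := Real.cos_sq_add_sin_sq θ
  simp only [Prod.mk_eq_zero] at h0
  rw [h0.1, h0.2] at h1
  norm_num at h1

lemma map_sphPt (h : IsNormFn ν) (θ : ℝ) : ν (sphPt ν θ) = 1 := by
  have := h.cos_sin_pos θ
  rw [sphPt, h.2.1, abs_of_pos (inv_pos.2 this), inv_mul_cancel₀ this.ne']

lemma planeDet_sphPt (θ φ : ℝ) : planeDet (sphPt ν θ) (sphPt ν φ) =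
    (ν (Real.cos θ, Real.sin θ))⁻¹ * (ν (Real.cos φ, Real.sin φ))⁻¹ * Real.sin (φ - θ) := by
  rw [Real.sin_sub]
  simp [planeDet, sphPt]
  ring

lemma fderiv_sphPt_ne_zero (h : IsNormFn ν) (hdiff : SmoothNorm ν) (θ : ℝ) :
    fderiv ℝ ν (sphPt ν θ) ≠ 0 := by
  intro h0
  have h1 := h.fderiv_self (hdiff _ (h.ne_zero_of_eq_one (h.map_sphPt θ)))
  rw [h0, h.map_sphPt] at h1
  simp at h1

lemma fderiv_sphPt_pos (h : IsNormFn ν) (hdiff : SmoothNorm ν) (hconv : StrictlyConvexNorm ν)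
    {θ φ : ℝ} {u : V2} (hu : IsPosUnitTangent ν θ u) (h1 : θ < φ) (h2 : φ < θ + Real.pi) :
    0 < fderiv ℝ ν (sphPt ν φ) u := by
  have hs : 0 < planeDet (sphPt ν θ) (sphPt ν φ) := by
    rw [planeDet_sphPt]
    have := Real.sin_pos_of_pos_of_lt_pi (sub_pos.2 h1) (by linarith)
    have := h.cos_sin_pos θ
    have := h.cos_sin_pos φ
    positivity
  exact pos_of_mul_pos_right (h.planeDet_mul_fderiv_pos hdiff hconv (h.map_sphPt θ)
    (h.map_sphPt φ) hu.2.1 hu.2.2 hs.ne') hs.le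

lemma fderiv_sphPt_neg (h : IsNormFn ν) (hdiff : SmoothNorm ν) (hconv : StrictlyConvexNorm ν)
    {θ φ : ℝ} {u : V2} (hu : IsPosUnitTangent ν θ u) (h1 : φ < θ) (h2 : θ < φ + Real.pi) :
    fderiv ℝ ν (sphPt ν φ) u < 0 := by
  have hs : planeDet (sphPt ν θ) (sphPt ν φ) < 0 := by
    rw [planeDet_sphPt]
    have := Real.sin_neg_of_neg_of_neg_pi_lt (sub_neg.2 h1) (by linarith)
    have := h.cos_sin_pos θ
    have := h.cos_sin_pos φ
    exact mul_neg_of_pos_of_neg (by positivity) ‹_›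
  have := h.planeDet_mul_fderiv_pos hdiff hconv (h.map_sphPt θ)
    (h.map_sphPt φ) hu.2.1 hu.2.2 hs.ne
  exact neg_of_mul_pos_right this hs.le

end IsNormFn

/-- The kernel of a nonzero linear functional on the plane is spanned by each of its nonzero
vectors. -/
lemma exists_eq_smul_of_apply_eq_zero {f : V2 →L[ℝ] ℝ} (hf : f ≠ 0) {v w : V2} (hw : w ≠ 0)
    (hfw : f w = 0) (hfv : f v = 0) : ∃ c : ℝ, v = c • w := by
  have hcoord : ∀ x : V2, f x = x.1 * f (1, 0) + x.2 * f (0, 1) := by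
    intro x
    have hx : x = x.1 • ((1, 0) : V2) + x.2 • ((0, 1) : V2) := by ext <;> simp
    conv_lhs => rw [hx]
    simp only [map_add, map_smul, smul_eq_mul]
  have hdet : v.1 * w.2 - v.2 * w.1 = 0 := by
    by_contra hne
    apply hf
    rw [hcoord] at hfw hfv
    have ha : f (1, 0) = 0 := by
      apply (mul_eq_zero.1 (?_ : (v.1 * w.2 - v.2 * w.1) * f (1, 0) = 0)).resolve_left hne
      linear_combination w.2 * hfv - v.2 * hfw
    have hb : f (0, 1) = 0 := by
      apply (mul_eq_zero.1 (?_ : (v.1 * w.2 - v.2 * w.1) * f (0, 1) = 0)).resolve_left hne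
      linear_combination v.1 * hfw - w.1 * hfv
    refine ContinuousLinearMap.ext fun x => ?_
    rw [hcoord, ha, hb]
    simp
  have hww : w.1 * w.1 + w.2 * w.2 ≠ 0 := by
    intro h0
    apply hw
    ext
    · simp; nlinarith [sq_nonneg w.1, sq_nonneg w.2]
    · simp; nlinarith [sq_nonneg w.1, sq_nonneg w.2]
  refine ⟨(v.1 * w.1 + v.2 * w.2) / (w.1 * w.1 + w.2 * w.2), ?_⟩
  ext
  · simp only [Prod.smul_fst, smul_eq_mul]
    rw [div_mul_eq_mul_div, eq_div_iff hww]
    linear_combination w.2 * hdet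
  · simp only [Prod.smul_snd, smul_eq_mul]
    rw [div_mul_eq_mul_div, eq_div_iff hww]
    linear_combination -w.1 * hdet

lemma existsUnique_pos_smul_add_parallel {f : V2 →L[ℝ] ℝ} {x y w : V2} (hw : w ≠ 0)
    (hfw : f w = 0) (hxy : f x * f y < 0) :
    ∃! lam : ℝ, 0 < lam ∧ ∃ c : ℝ, lam • x + y = c • w := by
  have hx : f x ≠ 0 := by
    intro h0
    simp [h0] at hxy
  have hf : f ≠ 0 := by
    rintro rfl
    simp at hx
  refine ⟨-f y / f x, ⟨?_, ?_⟩, ?_⟩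
  · have h1 : -f y / f x = -(f x * f y) / (f x * f x) := by field_simp
    rw [h1]
    exact div_pos (by linarith) (mul_self_pos.2 hx)
  · apply exists_eq_smul_of_apply_eq_zero hf hw hfw
    simp only [map_add, map_smul, smul_eq_mul]
    field_simp
    ring
  · rintro lam ⟨-, c, hc⟩
    have h1 := congrArg f hc
    simp only [map_add, map_smul, smul_eq_mul, hfw, mul_zero] at h1
    rw [eq_div_iff hx]
    linarith

/-- existence of brace parameters: for a differentiable strictly convex
norm and inclination `α`, the positively oriented unit tangent vectors `u_x`, `u_y` at the
directions `α` and `α + π/2` are linearly independent, and there are unique positive reals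
`λ`, `λ'` such that `λ u_x + u_y` is parallel to the tangent direction `w_b` at the sphere
point in the direction `α + π/4` and `-λ' u_x + u_y` is parallel to the tangent direction
`w_b'` at the sphere point in the direction `α + 3π/4`. -/
theorem statement8 (ν : V2 → ℝ) (hnorm : IsNormFn ν) (hdiff : SmoothNorm ν)
    (hconv : StrictlyConvexNorm ν) (α : ℝ) (hα0 : 0 ≤ α) (hα1 : α < Real.pi / 2)
    (ux uy wb wb' : V2)
    (hux : IsPosUnitTangent ν α ux) (huy : IsPosUnitTangent ν (α + Real.pi / 2) uy)
    (hwb : wb ≠ 0 ∧ IsTangentAt ν (sphPt ν (α + Real.pi / 4)) wb)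
    (hwb' : wb' ≠ 0 ∧ IsTangentAt ν (sphPt ν (α + 3 * Real.pi / 4)) wb') :
    LinearIndependent ℝ ![ux, uy] ∧
      (∃! lam : ℝ, 0 < lam ∧ ∃ c : ℝ, lam • ux + uy = c • wb) ∧
      (∃! lam' : ℝ, 0 < lam' ∧ ∃ c : ℝ, -lam' • ux + uy = c • wb') := by
  have hpi := Real.pi_pos
  have hxb := hnorm.fderiv_sphPt_pos hdiff hconv (φ := α + Real.pi / 4) hux
    (by linarith) (by linarith)
  have hyb := hnorm.fderiv_sphPt_neg hdiff hconv (φ := α + Real.pi / 4) huy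
    (by linarith) (by linarith)
  have hxb' := hnorm.fderiv_sphPt_pos hdiff hconv (φ := α + 3 * Real.pi / 4) hux
    (by linarith) (by linarith)
  have hyb' := hnorm.fderiv_sphPt_pos hdiff hconv (φ := α + 3 * Real.pi / 4) huy
    (by linarith) (by linarith)
  have hxy := hnorm.fderiv_sphPt_pos hdiff hconv (φ := α + Real.pi / 2) hux
    (by linarith) (by linarith)
  have hyx := hnorm.fderiv_sphPt_neg hdiff hconv (φ := α) huy (by linarith) (by linarith)
  have hxx : fderiv ℝ ν (sphPt ν α) ux = 0 := hux.2.1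
  have hyy : fderiv ℝ ν (sphPt ν (α + Real.pi / 2)) uy = 0 := huy.2.1
  refine ⟨?_, ?_, ?_⟩
  · rw [LinearIndependent.pair_iff]
    intro s t hst
    have e1 := congrArg (fderiv ℝ ν (sphPt ν α)) hst
    have e2 := congrArg (fderiv ℝ ν (sphPt ν (α + Real.pi / 2))) hst
    simp only [map_add, map_smul, smul_eq_mul, hxx, hyy, mul_zero, zero_add, add_zero, map_zero]
      at e1 e2
    exact ⟨(mul_eq_zero.1 e2).resolve_right hxy.ne', (mul_eq_zero.1 e1).resolve_right hyx.ne⟩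
  · exact existsUnique_pos_smul_add_parallel hwb.1 hwb.2 (mul_neg_of_pos_of_neg hxb hyb)
  · have h := existsUnique_pos_smul_add_parallel (x := -ux) (y := uy) hwb'.1 hwb'.2
      (by rw [map_neg]; exact mul_neg_of_neg_of_pos (neg_lt_zero.2 hxb') hyb')
    simpa only [smul_neg, neg_smul] using h
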